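/- Let n, N ≥ 1 and d ≥ 1 be integers, let p : ℝ^n → ℝ^N be a polynomial map of degree at most d, and let c > 0. Then for every affine subspace L ⊆ ℝ^N, the set im(p) ∩ {x ∈ ℝ^N : ‖x‖ ≤ c} ∩ L, equipped with the subspace topology, has at most (4d)^{n+1} connected components. -/

import Mathlib

/-- The polynomial map `ℝ^n → ℝ^N` whose coordinate functions are the
polynomials `P i`. -/
noncomputable def polyMap {n N : ℕ} (P : Fin N → MvPolynomial (Fin n) ℝ)
    (x : Fin n → ℝ) : EuclideanSpace ℝ (Fin N) :=
  WithLp.toLp 2 fun i => MvPolynomial.eval x (P i)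

open MvPolynomial Filter Topology

theorem MvPolynomial.totalDegree_pderiv_lt {σ R : Type*} [CommSemiring R] {p : MvPolynomial σ R}
    {e : ℕ} (he : 0 < e) (hp : p.totalDegree ≤ e) (i : σ) : (pderiv i p).totalDegree < e := by
  classical
  rw [totalDegree, Finset.sup_lt_iff (by simpa using he)]
  intro m hm
  rw [mem_support_iff, coeff_pderiv] at hm
  have h : m + Finsupp.single i 1 ∈ p.support := by
    rw [mem_support_iff]
    exact left_ne_zero_of_mul hm
  have h' := (le_totalDegree h).trans hp
  change Finsupp.degree (m + Finsupp.single i 1) ≤ e at h'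
  change Finsupp.degree m < e
  rw [map_add, Finsupp.degree_single] at h'
  omega

theorem MvPolynomial.hasDerivAt_eval_update {σ : Type*} [DecidableEq σ]
    (p : MvPolynomial σ ℝ) (x : σ → ℝ) (i : σ) :
    HasDerivAt (fun t => eval (Function.update x i t) p) (eval x (pderiv i p)) (x i) := by
  induction p using MvPolynomial.induction_on with
  | C a => simpa using hasDerivAt_const (x i) a
  | add p q hp hq =>
    simp only [map_add]
    exact hp.add hq
  | mul_X p j hp =>
    have hX : HasDerivAt (fun t => Function.update x i t j) (eval x (pderiv i (X j))) (x i) := by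
      rcases eq_or_ne j i with rfl | h
      · simpa using hasDerivAt_id' (x j)
      · simpa [h, pderiv_X_of_ne h] using hasDerivAt_const (x i) (x j)
    have h := hp.mul hX
    simp only [Function.update_eq_self] at h
    simp only [map_mul, pderiv_mul, map_add, eval_X]
    exact h

theorem MvPolynomial.eval_pderiv_eq_zero_of_isLocalMin {σ : Type*} (p : MvPolynomial σ ℝ)
    {x : σ → ℝ} (h : IsLocalMin (fun y => eval y p) x) (i : σ) : eval x (pderiv i p) = 0 := by
  classical
  refine IsLocalMin.hasDerivAt_eq_zero (a := x i) ?_ (p.hasDerivAt_eval_update x i)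
  have hc : Tendsto (fun t => Function.update x i t) (𝓝 (x i)) (𝓝 x) := by
    have : Continuous (fun t => Function.update x i t) := by fun_prop
    simpa using this.tendsto (x i)
  have := hc.eventually h
  simpa [IsLocalMin, IsMinFilter] using this

/-- A Bézout bound: a system of equations `c * X i ^ e + r i = 0`, one for each variable, with every
`r i` of degree less than `e`, has at most `e ^ m` solutions, where `m` is the number of variables. -/
theorem MvPolynomial.card_le_of_common_zeros {σ ι K : Type*} [Fintype σ] [Fintype ι] [Field K]
    {e : ℕ} {c : K} (hc : c ≠ 0) (r : σ → MvPolynomial σ K) (hr : ∀ i, (r i).totalDegree < e)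
    (a : ι → σ → K) (ha : Function.Injective a)
    (hz : ∀ j i, eval (a j) (C c * X i ^ e + r i) = 0) :
    Fintype.card ι ≤ e ^ Fintype.card σ := by
  classical
  have hli : LinearIndependent K (fun j => ((eval (a j) : MvPolynomial σ K →+* K) :
      MvPolynomial σ K → K)) := by
    refine (linearIndependent_monoidHom (MvPolynomial σ K) K).comp
      (fun j => ((eval (a j) : MvPolynomial σ K →+* K) : MvPolynomial σ K →* K)) ?_
    intro j k h
    apply ha
    funext i
    simpa using DFunLike.congr_fun h (X i)
  have hred : LinearIndependent K (fun j => fun s : σ → Fin e => ∏ i, a j i ^ (s i : ℕ)) := by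
    rw [Fintype.linearIndependent_iff] at hli ⊢
    intro w hw
    apply hli
    have hdeg : ∀ (D : ℕ) (p : MvPolynomial σ K), p.totalDegree ≤ D →
        ∑ j, w j * eval (a j) p = 0 := by
      intro D
      induction D using Nat.strong_induction_on with
      | _ D ih =>
      intro p hp
      have hmon : ∀ s ∈ p.support, ∑ j, w j * eval (a j) (monomial s (coeff s p)) = 0 := by
        intro s hs
        have hsD : Finsupp.degree s ≤ D := (le_totalDegree hs).trans hp
        by_cases hsmall : ∀ i, s i < e
        · have := congrFun hw (fun i => ⟨s i, hsmall i⟩)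
          simp only [Finset.sum_apply, Pi.smul_apply, smul_eq_mul, Pi.zero_apply] at this
          calc _ = coeff s p * ∑ j, w j * ∏ i, a j i ^ s i := by
                rw [Finset.mul_sum]
                refine Finset.sum_congr rfl fun j _ => ?_
                rw [eval_monomial, Finsupp.prod_fintype _ _ (by simp)]
                ring
            _ = 0 := by rw [this, mul_zero]
        · push Not at hsmall
          obtain ⟨i, hi⟩ := hsmall
          obtain ⟨t, rfl⟩ : ∃ t, s = t + Finsupp.single i e :=
            ⟨s - Finsupp.single i e, (tsub_add_cancel_of_le (by simpa using hi)).symm⟩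
          rw [map_add, Finsupp.degree_single] at hsD
          have hlow : (monomial t (1 : K) * r i).totalDegree < D := by
            have h1 := totalDegree_mul (monomial t (1 : K)) (r i)
            have h2 : (monomial t (1 : K)).totalDegree = Finsupp.degree t :=
              totalDegree_monomial _ one_ne_zero
            have := hr i
            omega
          have := ih _ hlow _ le_rfl
          calc _ = -(coeff (t + Finsupp.single i e) p / c) *
                  ∑ j, w j * eval (a j) (monomial t (1 : K) * r i) := by
                rw [Finset.mul_sum]
                refine Finset.sum_congr rfl fun j _ => ?_
                have hzj := hz j i
                have hri : eval (a j) (r i) = -(c * a j i ^ e) := by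
                  simp only [map_add, map_mul, map_pow, eval_C, eval_X] at hzj
                  linear_combination hzj
                have hmono : monomial (t + Finsupp.single i e) (coeff (t + Finsupp.single i e) p) =
                    C (coeff (t + Finsupp.single i e) p) * (monomial t 1 * X i ^ e) := by
                  rw [X_pow_eq_monomial, monomial_mul, C_mul_monomial]
                  simp
                rw [hmono]
                simp only [map_mul, hri, eval_C, map_pow, eval_X]
                field_simp
            _ = 0 := by rw [this, mul_zero]
      calc _ = ∑ j, w j * eval (a j) (∑ s ∈ p.support, monomial s (coeff s p)) := by
            rw [support_sum_monomial_coeff]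
        _ = ∑ s ∈ p.support, ∑ j, w j * eval (a j) (monomial s (coeff s p)) := by
            simp only [map_sum, Finset.mul_sum]
            rw [Finset.sum_comm]
        _ = 0 := Finset.sum_eq_zero hmon
    funext p
    simpa using hdeg _ p le_rfl
  simpa using hred.fintype_card_le_finrank

/-- A strict inequality `φ a < φ x` on a compact set persists under small perturbations of `φ`. -/
theorem IsCompact.eventually_lt_add_mul {X : Type*} [TopologicalSpace X] {W : Set X}
    (hW : IsCompact W) {φ ψ : X → ℝ} (hφ : Continuous φ) (hψ : Continuous ψ) {a : X}
    (h : ∀ x ∈ W, φ a < φ x) :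
    ∀ᶠ η in 𝓝[>] (0 : ℝ), ∀ x ∈ W, φ a + η * ψ a < φ x + η * ψ x := by
  refine Filter.Eventually.filter_mono nhdsWithin_le_nhds ?_
  refine hW.eventually_forall_of_forall_eventually fun x hx => ?_
  refine ContinuousAt.eventually_lt (by fun_prop) (by fun_prop) ?_
  simpa using h x hx

/-- A space admitting no continuous surjection to `Fin k` with `k > M` has at most `M` connected
components. -/
theorem ConnectedComponents.finite_and_card_le {X : Type*} [TopologicalSpace X] {M : ℕ}
    (h : ∀ (k : ℕ) (u : X → Fin k), Continuous u → Function.Surjective u → k ≤ M) :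
    Finite (ConnectedComponents X) ∧ Nat.card (ConnectedComponents X) ≤ M := by
  have hfin : Finite (ConnectedComponents X) := by
    by_contra hinf
    rw [not_finite_iff_infinite] at hinf
    obtain ⟨U, hU, hne, hdisj, hcov⟩ :=
      ConnectedComponents.exists_fun_isClopen_of_infinite X (M + 1) M.succ_pos
    choose u hu using fun x => Set.mem_iUnion.1 (hcov.symm ▸ Set.mem_univ x : x ∈ ⋃ i, U i)
    have huU : ∀ {x i}, x ∈ U i → u x = i := fun {x i} hx => by
      by_contra hne
      exact Set.disjoint_left.1 (hdisj hne) (hu x) hx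
    have hpre : ∀ i, u ⁻¹' {i} = U i := fun i => by
      ext x
      exact ⟨fun hx => (show u x = i from hx) ▸ hu x, huU⟩
    have := h (M + 1) u
      (continuous_discrete_rng.2 fun i => (hpre i).symm ▸ (hU i).isOpen)
      (fun i => (hne i).imp fun x => huU)
    omega
  refine ⟨hfin, ?_⟩
  let φ := Finite.equivFin (ConnectedComponents X)
  exact h _ (φ ∘ ConnectedComponents.mk)
    (continuous_of_discreteTopology.comp ConnectedComponents.continuous_coe)
    (φ.surjective.comp ConnectedComponents.surjective_coe)

theorem isCompact_setOf_sum_sq_le {σ : Type*} [Fintype σ] (R : ℝ) :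
    IsCompact {y : σ → ℝ | ∑ i, y i ^ 2 ≤ R} := by
  refine Metric.isCompact_of_isClosed_isBounded (isClosed_le (by fun_prop) continuous_const) ?_
  refine (Metric.isBounded_closedBall (x := (0 : σ → ℝ)) (r := √R)).subset fun y hy => ?_
  rw [Metric.mem_closedBall, dist_pi_le_iff (Real.sqrt_nonneg R)]
  intro i
  rw [Real.dist_eq, Pi.zero_apply, sub_zero]
  exact Real.abs_le_sqrt ((Finset.single_le_sum (f := fun i => y i ^ 2)
    (fun i _ => sq_nonneg (y i)) (Finset.mem_univ i)).trans hy)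

/-- The fibres of a continuous map from a closed set `Z` to `Fin k` have pairwise disjoint open
neighbourhoods. -/
theorem IsClosed.exists_disjoint_open_of_continuous {X : Type*} [TopologicalSpace X]
    [NormalSpace X] {Z : Set X} (hZ : IsClosed Z) {k : ℕ} {u : Z → Fin k} (hu : Continuous u) :
    ∃ U : Fin k → Set X, (∀ i, IsOpen (U i)) ∧ Pairwise (Function.onFun Disjoint U) ∧
      ∀ x : Z, (x : X) ∈ U (u x) := by
  let v : C(Z, ℝ) := ⟨fun x => ((u x : ℕ) : ℝ), by
    exact (continuous_of_discreteTopology (f := fun i : Fin k => ((i : ℕ) : ℝ))).comp hu⟩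
  obtain ⟨F, hF⟩ := v.exists_restrict_eq hZ
  refine ⟨fun i => {x | |F x - (i : ℕ)| < 1 / 2}, fun i => ?_, fun i j hij => ?_, fun x => ?_⟩
  · exact isOpen_lt (by fun_prop) continuous_const
  · refine Set.disjoint_left.2 fun x hi hj => hij ?_
    simp only [Set.mem_ofPred_eq, abs_lt] at hi hj
    have h1 : ((i : ℕ) : ℝ) < (j : ℕ) + 1 := by linarith
    have h2 : ((j : ℕ) : ℝ) < (i : ℕ) + 1 := by linarith
    norm_cast at h1 h2
    omega
  · have : F x = (u x : ℕ) := DFunLike.congr_fun hF x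
    simp [this]

/-- The zero set of a nonnegative polynomial of degree at most `e` in `m` variables cannot be split
into more than `e ^ m` nonempty clopen pieces: a perturbation of the polynomial by small multiples of
`∑ X i ^ 2` and `∑ X i ^ (e + 1)` has a local minimum near each piece. -/
theorem MvPolynomial.le_pow_card_of_continuous_surjective_zeros {σ : Type*} [Fintype σ]
    (f : MvPolynomial σ ℝ) {e : ℕ} (he : 2 ≤ e) (hdeg : f.totalDegree ≤ e)
    (hf : ∀ x, 0 ≤ eval x f) {k : ℕ} {u : {x | eval x f = 0} → Fin k} (hu : Continuous u)
    (hsurj : Function.Surjective u) : k ≤ e ^ Fintype.card σ := by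
  classical
  have hfc : Continuous fun x => eval x f := f.continuous_eval
  have hZ : IsClosed {x | eval x f = 0} := isClosed_eq hfc continuous_const
  obtain ⟨U, hUo, hUd, hUu⟩ := hZ.exists_disjoint_open_of_continuous hu
  choose a ha using hsurj
  let q : (σ → ℝ) → ℝ := fun x => ∑ i, x i ^ 2
  let s : (σ → ℝ) → ℝ := fun x => ∑ i, x i ^ (e + 1)
  have hq : Continuous q := by fun_prop
  have hs : Continuous s := by fun_prop
  obtain ⟨R, hR⟩ : ∃ R, ∀ i, q (a i) < R :=
    ⟨∑ i, q (a i) + 1, fun i => by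
      have := Finset.single_le_sum (f := fun i => q (a i))
        (fun i _ => Finset.sum_nonneg fun j _ => sq_nonneg ((a i).1 j)) (Finset.mem_univ i)
      linarith⟩
  have haU : ∀ i, (a i : σ → ℝ) ∈ U i := fun i => by simpa [ha] using hUu (a i)
  have ha0 : ∀ i, eval (a i : σ → ℝ) f = 0 := fun i => (a i).2
  have hB : IsCompact {x | q x ≤ R} := isCompact_setOf_sum_sq_le R
  have hfront : ∀ i, ∀ x ∈ frontier (U i), eval (a i : σ → ℝ) f < eval x f := by
    intro i x hx
    rw [ha0]
    refine (hf x).lt_of_ne fun h0 => ?_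
    have hxU := hUu ⟨x, h0.symm⟩
    by_cases hi : u ⟨x, h0.symm⟩ = i
    · rw [hi] at hxU
      rw [(hUo i).frontier_eq] at hx
      exact hx.2 hxU
    · exact Set.disjoint_left.1 ((hUd hi).closure_right (hUo _)) hxU (frontier_subset_closure hx)
  have hε : ∀ᶠ ε in 𝓝[>] (0 : ℝ), ∀ i, ∀ x ∈ {x | q x ≤ R} ∩ frontier (U i),
      eval (a i : σ → ℝ) f + ε * q (a i) < eval x f + ε * q x :=
    eventually_all.2 fun i => (hB.inter_right isClosed_frontier).eventually_lt_add_mul hfc hq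
      fun x hx => hfront i x hx.2
  obtain ⟨ε, hε, hε0⟩ := (hε.and self_mem_nhdsWithin).exists
  replace hε0 : 0 < ε := hε0
  let W : Fin k → Set (σ → ℝ) := fun i =>
    ({x | q x ≤ R} ∩ closure (U i)) \ ({x | q x < R} ∩ U i)
  have hW : ∀ i, IsCompact (W i) := fun i =>
    (hB.inter_right isClosed_closure).diff ((isOpen_lt hq continuous_const).inter (hUo i))
  have hWlt : ∀ i, ∀ x ∈ W i,
      eval (a i : σ → ℝ) f + ε * q (a i) < eval x f + ε * q x := by
    rintro i x ⟨⟨hxR, hxc⟩, hx⟩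
    by_cases hxU : x ∈ U i
    · have hxq : q x = R := le_antisymm hxR (not_lt.1 fun h => hx ⟨h, hxU⟩)
      rw [ha0, hxq]
      have := mul_lt_mul_of_pos_left (hR i) hε0
      linarith [hf x]
    · exact hε i x ⟨hxR, (hUo i).frontier_eq ▸ ⟨hxc, hxU⟩⟩
  have hη : ∀ᶠ η in 𝓝[>] (0 : ℝ), ∀ i, ∀ x ∈ W i,
      eval (a i : σ → ℝ) f + ε * q (a i) + η * s (a i) < eval x f + ε * q x + η * s x :=
    eventually_all.2 fun i => (hW i).eventually_lt_add_mul
      (φ := fun x => eval x f + ε * q x) (by fun_prop) hs (hWlt i)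
  obtain ⟨η, hη, hη0⟩ := (hη.and self_mem_nhdsWithin).exists
  replace hη0 : 0 < η := hη0
  let g : MvPolynomial σ ℝ := f + C ε * ∑ i, X i ^ 2 + C η * ∑ i, X i ^ (e + 1)
  have hg : ∀ x, eval x g = eval x f + ε * q x + η * s x := fun x => by simp [g, q, s]
  have hmin : ∀ i, ∃ x ∈ U i, IsLocalMin (fun y => eval y g) x := by
    intro i
    obtain ⟨x, hx, hxmin⟩ := (hB.inter_right (isClosed_closure (s := U i))).exists_isMinOn
      ⟨a i, (hR i).le, subset_closure (haU i)⟩ g.continuous_eval.continuousOn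
    have hxV : x ∈ {x | q x < R} ∩ U i := by
      by_contra hxV
      have h1 := hη i x ⟨hx, hxV⟩
      rw [← hg, ← hg] at h1
      exact h1.not_ge (hxmin ⟨(hR i).le, subset_closure (haU i)⟩)
    refine ⟨x, hxV.2, hxmin.isLocalMin ?_⟩
    filter_upwards [((isOpen_lt hq continuous_const).inter (hUo i)).mem_nhds hxV] with y hy
    exact ⟨(show q y < R from hy.1).le, subset_closure hy.2⟩
  choose b hbU hb using hmin
  have hbinj : Function.Injective b := fun i j hij => by
    by_contra hne
    exact Set.disjoint_left.1 (hUd hne) (hbU i) (hij ▸ hbU j)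
  have hpow : ∀ (i : σ) (n : ℕ), pderiv i (∑ j, (X j : MvPolynomial σ ℝ) ^ (n + 1)) =
      C (n + 1 : ℝ) * X i ^ n := by
    intro i n
    rw [map_sum, Finset.sum_eq_single i]
    · simp
    · intro j _ hj
      simp [pderiv_X_of_ne hj]
    · simp
  have hgd : ∀ i, pderiv i g =
      C (η * (e + 1)) * X i ^ e + (pderiv i f + C (2 * ε) * X i) := by
    intro i
    have h2 : pderiv i (∑ j, (X j : MvPolynomial σ ℝ) ^ 2) = C 2 * X i := by
      rw [hpow i 1]
      norm_num
    simp only [g, map_add, pderiv_C_mul, h2, hpow i e, C_mul]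
    ring
  have := card_le_of_common_zeros (c := η * (e + 1)) (by positivity)
    (fun i => pderiv i f + C (2 * ε) * X i) (e := e) (fun i => ?_) b hbinj (fun j i => ?_)
  · simpa using this
  · refine (totalDegree_add _ _).trans_lt (max_lt (totalDegree_pderiv_lt (by omega) hdeg i) ?_)
    refine (totalDegree_mul _ _).trans_lt ?_
    rw [totalDegree_C, totalDegree_X]
    omega
  · rw [← hgd]
    exact eval_pderiv_eq_zero_of_isLocalMin g (hb j) i

/-- An affine subspace is the solution set of a finite system of affine equations. -/
theorem AffineSubspace.exists_matrix_mem_iff {ι : Type*} [Fintype ι]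
    (L : AffineSubspace ℝ (EuclideanSpace ℝ ι)) (hL : (L : Set (EuclideanSpace ℝ ι)).Nonempty) :
    ∃ (A : Matrix ι ι ℝ) (w : ι → ℝ), ∀ v : EuclideanSpace ℝ ι,
      v ∈ L ↔ ∀ i, ∑ j, A i j * (v j - w j) = 0 := by
  classical
  obtain ⟨w, hw⟩ := hL
  let T : EuclideanSpace ℝ ι →ₗ[ℝ] EuclideanSpace ℝ ι := (L.directionᗮ).starProjection
  obtain ⟨A, hA⟩ := Matrix.toEuclideanLin.surjective T
  refine ⟨A, w, fun v => ?_⟩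
  have hT : v ∈ L ↔ T (v - w) = 0 := by
    rw [← L.vsub_right_mem_direction_iff_mem hw, vsub_eq_sub]
    change _ ↔ (L.directionᗮ).starProjection (v - w) = 0
    rw [Submodule.starProjection_apply_eq_zero_iff, Submodule.orthogonal_orthogonal]
  rw [hT, ← hA, PiLp.ext_iff]
  rfl

/-- The intersection of the image of a polynomial map of degree at most `d`
with a closed Euclidean ball of radius `c` around the origin and any affine
subspace has at most `(4d)^(n+1)` connected components. -/
theorem image_polyMap_ball_inter_affine_components (n N d : ℕ)
    (hn : 1 ≤ n) (hN : 1 ≤ N) (hd : 1 ≤ d) (c : ℝ) (hc : 0 < c)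
    (P : Fin N → MvPolynomial (Fin n) ℝ) (hdeg : ∀ i, (P i).totalDegree ≤ d)
    (L : AffineSubspace ℝ (EuclideanSpace ℝ (Fin N)))
    (hL : (L : Set (EuclideanSpace ℝ (Fin N))).Nonempty) :
    Finite (ConnectedComponents
      ↥(Set.range (polyMap P) ∩ Metric.closedBall (0 : EuclideanSpace ℝ (Fin N)) c
        ∩ (L : Set (EuclideanSpace ℝ (Fin N))))) ∧
    Nat.card (ConnectedComponents
      ↥(Set.range (polyMap P) ∩ Metric.closedBall (0 : EuclideanSpace ℝ (Fin N)) c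
        ∩ (L : Set (EuclideanSpace ℝ (Fin N)))))
      ≤ (4 * d) ^ (n + 1) := by
  obtain ⟨A, w, hA⟩ := L.exists_matrix_mem_iff hL
  refine ConnectedComponents.finite_and_card_le fun k u hu hsurj => ?_
  let S : MvPolynomial (Option (Fin n)) ℝ :=
    ∑ j, rename some (P j) ^ 2 + X none ^ 2 - C (c ^ 2)
  let Q : Fin N → MvPolynomial (Option (Fin n)) ℝ := fun i =>
    ∑ j, C (A i j) * (rename some (P j) - C (w j))
  let f : MvPolynomial (Option (Fin n)) ℝ := S ^ 2 + ∑ i, Q i ^ 2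
  have hP : ∀ j, (rename (some : Fin n → Option (Fin n)) (P j)).totalDegree ≤ d := fun j =>
    (totalDegree_rename_le _ _).trans (hdeg j)
  have hsq : ∀ {p : MvPolynomial (Option (Fin n)) ℝ} {m : ℕ}, p.totalDegree ≤ m →
      (p ^ 2).totalDegree ≤ 2 * m := fun {p m} h =>
    (totalDegree_pow p 2).trans (Nat.mul_le_mul_left 2 h)
  have hS : S.totalDegree ≤ 2 * d := by
    refine (totalDegree_sub_C_le _ _).trans ((totalDegree_add _ _).trans (max_le ?_ ?_))
    · exact totalDegree_finsetSum_le fun j _ => hsq (hP j)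
    · exact hsq (by simpa using hd)
  have hQ : ∀ i, (Q i).totalDegree ≤ d := fun i => by
    refine totalDegree_finsetSum_le fun j _ => (totalDegree_mul _ _).trans ?_
    rw [totalDegree_C, zero_add]
    exact (totalDegree_sub_C_le _ _).trans (hP j)
  have hfdeg : f.totalDegree ≤ 4 * d := by
    refine (totalDegree_add _ _).trans (max_le ((hsq hS).trans (by omega)) ?_)
    exact totalDegree_finsetSum_le fun i _ => (hsq (hQ i)).trans (by omega)
  have hfeval : ∀ y, eval y f = eval y S ^ 2 + ∑ i, eval y (Q i) ^ 2 := fun y => by simp [f]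
  have hsum : ∀ y, 0 ≤ ∑ i, eval y (Q i) ^ 2 := fun y => Finset.sum_nonneg fun i _ => sq_nonneg _
  have hzero : ∀ y, eval y f = 0 ↔
      ‖polyMap P (y ∘ some)‖ ^ 2 + y none ^ 2 = c ^ 2 ∧ polyMap P (y ∘ some) ∈ L := by
    intro y
    rw [hfeval, add_eq_zero_iff_of_nonneg (sq_nonneg _) (hsum y), sq_eq_zero_iff,
      Finset.sum_eq_zero_iff_of_nonneg fun i _ => sq_nonneg _, hA, EuclideanSpace.norm_sq_eq]
    refine and_congr ?_ ?_
    · simp [S, polyMap, eval_rename, sub_eq_zero]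
    · simp [Q, polyMap, eval_rename]
  have hcont : Continuous (polyMap P) :=
    (PiLp.continuous_toLp 2 _).comp (continuous_pi fun i => (P i).continuous_eval)
  let π : {y | eval y f = 0} → ↥(Set.range (polyMap P) ∩
      Metric.closedBall (0 : EuclideanSpace ℝ (Fin N)) c ∩
      (L : Set (EuclideanSpace ℝ (Fin N)))) := fun y =>
    ⟨polyMap P (y.1 ∘ some), ⟨⟨_, rfl⟩, by
      have h := ((hzero y.1).1 y.2).1
      rw [mem_closedBall_zero_iff]
      exact le_of_sq_le_sq (by nlinarith [sq_nonneg (y.1 none)]) hc.le⟩, ((hzero y.1).1 y.2).2⟩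
  have hπ : Continuous π := by
    refine Continuous.subtype_mk (hcont.comp ?_) _
    exact continuous_pi fun i => (continuous_apply _).comp continuous_subtype_val
  have hπsurj : Function.Surjective π := by
    rintro ⟨_, ⟨⟨x, rfl⟩, hxc⟩, hxL⟩
    rw [mem_closedBall_zero_iff] at hxc
    have h0 : 0 ≤ c ^ 2 - ‖polyMap P x‖ ^ 2 :=
      sub_nonneg.2 (pow_le_pow_left₀ (norm_nonneg _) hxc 2)
    let y : Option (Fin n) → ℝ := fun o => o.elim √(c ^ 2 - ‖polyMap P x‖ ^ 2) x
    have hy : y ∘ some = x := rfl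
    refine ⟨⟨y, (hzero y).2 ⟨?_, hxL⟩⟩, rfl⟩
    rw [hy]
    change _ + √(c ^ 2 - ‖polyMap P x‖ ^ 2) ^ 2 = _
    rw [Real.sq_sqrt h0]
    ring
  have := le_pow_card_of_continuous_surjective_zeros f (e := 4 * d) (by omega) hfdeg
    (fun y => by rw [hfeval]; exact add_nonneg (sq_nonneg _) (hsum y))
    (hu.comp hπ) (hsurj.comp hπsurj)
  simpa using this
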